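/- arXiv:2511.09718 — 2 statements merged into one kernel-verified Lean document; each statement's English description precedes it below -/
import Mathlib

section
/- There exists a residual set G ⊆ C([0,1]) such that for every g ∈ G and every x ∈ [0,1], the basin of attraction of the ω-limit set of x has Lebesgue measure zero: λ({y ∈ [0,1] : ω_g(y) ⊆ ω_g(x)}) = 0. In particular, for every ergodic g-invariant Borel probability measure μ, λ({y : ω_g(y) ⊆ supp(μ)}) = 0. -/
open MeasureTheory Set Filter Topology

noncomputable section

/-- The unit interval `[0,1]` as a subtype of `ℝ`. -/
abbrev I01 : Type := Set.Icc (0:ℝ) 1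

/-- The ω-limit set of `x` under `f`. -/
def omegaLim {X : Type*} [TopologicalSpace X] (f : X → X) (x : X) : Set X :=
  ⋂ n : ℕ, closure {y | ∃ m, n ≤ m ∧ f^[m] x = y}

/-- The basin of attraction of a set `A`. -/
def basin {X : Type*} [TopologicalSpace X] (f : X → X) (A : Set X) : Set X :=
  {x | omegaLim f x ⊆ A}

/-- The (topological) support of a measure. -/
def measSupport {X : Type*} [TopologicalSpace X] [MeasurableSpace X]
    (μ : Measure X) : Set X :=
  {x | ∀ U : Set X, IsOpen U → x ∈ U → 0 < μ U}

theorem omegaLim_nonempty {X : Type*} [TopologicalSpace X] [CompactSpace X] (f : X → X) (x : X) :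
    (omegaLim f x).Nonempty := by
  refine IsCompact.nonempty_iInter_of_sequence_nonempty_isCompact_isClosed _ (fun n => ?_)
    (fun n => ⟨f^[n] x, subset_closure ⟨n, le_rfl, rfl⟩⟩) isClosed_closure.isCompact
    (fun n => isClosed_closure)
  refine closure_mono ?_
  rintro y ⟨m, hm, rfl⟩
  exact ⟨m, by omega, rfl⟩

/-- If `f` maps the closure of `U` into `U`, the ω-limit set of a point whose orbit meets `U`
lies in `U`. -/
theorem omegaLim_subset_of_iterate_mem {X : Type*} [TopologicalSpace X] [CompactSpace X] [T2Space X]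
    {f : X → X} (hf : Continuous f) {U : Set X} (hU : MapsTo f (closure U) U) {x : X} {n : ℕ}
    (hx : f^[n] x ∈ U) : omegaLim f x ⊆ U := by
  have hc : IsClosed (f '' closure U) := (isClosed_closure.isCompact.image hf).isClosed
  refine ((iInter_subset _ (n + 1)).trans (closure_minimal ?_ hc)).trans hU.image_subset
  rintro y ⟨m, hm, rfl⟩
  obtain ⟨k, rfl⟩ := Nat.exists_eq_add_of_le' hm
  rw [← add_assoc, add_right_comm, Nat.add_right_comm, Function.iterate_succ_apply',
    Function.iterate_add_apply]
  exact mem_image_of_mem f (subset_closure ((hU.mono_left subset_closure).iterate k hx))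

theorem exists_iterate_mem_of_mem_omegaLim {X : Type*} [TopologicalSpace X] {f : X → X}
    {U : Set X} (hU : IsOpen U) {x y : X} (hy : y ∈ omegaLim f x) (hyU : y ∈ U) :
    ∃ n, f^[n] x ∈ U := by
  obtain ⟨z, hzU, m, -, rfl⟩ := mem_closure_iff.1 (mem_iInter.1 hy 0) U hU hyU
  exact ⟨m, hzU⟩

/-- The maps with `m + 1` disjoint trapping regions, any `m` of which cover `[0,1]` up to measure
`2 / (m + 1)`. -/
def trapSplit (m : ℕ) : Set C(I01, I01) :=
  {g | ∃ U : Fin (m + 1) → Set I01, (∀ j, IsOpen (U j)) ∧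
    (∀ i j, (U i ∩ U j).Nonempty → i = j) ∧
    (∀ j, MapsTo g (closure (U j)) (U j)) ∧
    ∀ j, volume (⋃ i ∈ {i | i ≠ j}, U i)ᶜ ≤ ENNReal.ofReal (2 / (m + 1))}

theorem isOpen_trapSplit (m : ℕ) : IsOpen (trapSplit m) := by
  rw [isOpen_iff_mem_nhds]
  rintro g ⟨U, hU, hd, hg, hv⟩
  have : ∀ᶠ h : C(I01, I01) in 𝓝 g, ∀ j, MapsTo h (closure (U j)) (U j) :=
    eventually_all.2 fun j =>
      ContinuousMap.eventually_mapsTo isClosed_closure.isCompact (hU j) (hg j)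
  filter_upwards [this] with h hh
  exact ⟨U, hU, hd, hh, hv⟩

theorem volume_basin_le {m : ℕ} {g : C(I01, I01)} {U : Fin (m + 1) → Set I01}
    (hg : ∀ j, MapsTo g (closure (U j)) (U j))
    (hv : ∀ j, volume (⋃ i ∈ {i | i ≠ j}, U i)ᶜ ≤ ENNReal.ofReal (2 / (m + 1)))
    {A : Set I01} (hA : ∀ i j, (A ∩ U i).Nonempty → (A ∩ U j).Nonempty → i = j) :
    volume (basin g A) ≤ ENNReal.ofReal (2 / (m + 1)) := by
  obtain ⟨j, hj⟩ : ∃ j, ∀ i, (A ∩ U i).Nonempty → i = j := by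
    by_cases h : ∃ j, (A ∩ U j).Nonempty
    · obtain ⟨j, hj⟩ := h
      exact ⟨j, fun i hi => hA i j hi hj⟩
    · exact ⟨0, fun i hi => (h ⟨i, hi⟩).elim⟩
  refine (measure_mono ?_).trans (hv j)
  intro y hy hyU
  simp only [mem_iUnion] at hyU
  obtain ⟨i, hij, hyi⟩ := hyU
  obtain ⟨z, hz⟩ := omegaLim_nonempty g y
  exact hij (hj i ⟨z, hy hz, omegaLim_subset_of_iterate_mem g.continuous (hg i) (n := 0) hyi hz⟩)

/-- A continuous map close to `f` on a closed set extends to a continuous map close to `f`. -/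
theorem exists_dist_le_eqOn (f : C(I01, I01)) {K : Set I01} (hK : IsClosed K) {c : I01 → I01}
    (hc : ContinuousOn c K) {ε : ℝ} (hε : 0 ≤ ε) (hd : ∀ x ∈ K, |(c x : ℝ) - f x| ≤ ε) :
    ∃ g : C(I01, I01), dist g f ≤ ε ∧ EqOn g c K := by
  have hcont : Continuous fun x : K => ((c x : ℝ) - f x) :=
    (continuous_subtype_val.comp hc.domRestrict).sub
      (continuous_subtype_val.comp (f.continuous.comp continuous_subtype_val))
  obtain ⟨D, hD, hDK⟩ := ContinuousMap.exists_restrict_eq_forall_mem_of_closed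
    (⟨_, hcont⟩ : C(K, ℝ)) (t := Icc (-ε) ε) (fun x => abs_le.1 (hd x x.2))
    ⟨0, by simpa using hε⟩ hK
  refine ⟨⟨fun x => projIcc 0 1 zero_le_one ((f x : ℝ) + D x), by fun_prop⟩, ?_, ?_⟩
  · rw [ContinuousMap.dist_le hε]
    intro x
    have h := (LipschitzWith.projIcc (zero_le_one (α := ℝ))).dist_le_mul ((f x : ℝ) + D x) (f x)
    rw [projIcc_val] at h
    refine h.trans ?_
    simpa [Real.dist_eq] using abs_le.2 (hD x)
  · intro x hx
    have h : D x = (c x : ℝ) - f x := DFunLike.congr_fun hDK ⟨x, hx⟩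
    simp [h]

/-- Every point of `[0,1]` is within `1 / N` of the midpoint of a cell of colour `j` when the cells
of the subdivision into `N * M` cells are coloured periodically by `M` colours. -/
theorem exists_midpoint_near {N M j : ℕ} (hN : 0 < N) (hj : j < M) (y : I01) :
    ∃ (c : I01) (k : ℕ), k < N * M ∧ k % M = j ∧ (N * M : ℝ) * c = k + 1 / 2 ∧
      |(c : ℝ) - y| ≤ 1 / N := by
  obtain ⟨a, haN, hay, hya⟩ : ∃ a : ℕ, a + 1 ≤ N ∧ (a : ℝ) ≤ N * y ∧ (N : ℝ) * y ≤ a + 1 := by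
    have hNy : (0 : ℝ) ≤ N * y := mul_nonneg (by positivity) y.2.1
    have hN0 : (0 : ℝ) < N := by exact_mod_cast hN
    rcases lt_or_ge ⌊(N : ℝ) * y⌋₊ N with h | h
    · exact ⟨_, h, Nat.floor_le hNy, (Nat.lt_floor_add_one _).le⟩
    · have h1 : (N : ℝ) ≤ N * y := (Nat.le_floor_iff hNy).1 h
      have h2 : (N : ℝ) * y ≤ N := by nlinarith [y.2.2]
      obtain ⟨n, rfl⟩ := Nat.exists_eq_add_of_lt hN
      refine ⟨n, by omega, ?_, ?_⟩ <;> push_cast at * <;> linarith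
  have hN0 : (0 : ℝ) < N := by exact_mod_cast hN
  have hM0 : (0 : ℝ) < M := by exact_mod_cast (by omega : 0 < M)
  have hk : M * a + j < N * M := by nlinarith
  have hj' : (j : ℝ) + 1 ≤ M := by exact_mod_cast hj
  have hk' : ((M * a + j : ℕ) : ℝ) + 1 ≤ N * M := by exact_mod_cast hk
  refine ⟨⟨((M * a + j : ℕ) + 1 / 2) / (N * M), by positivity, ?_⟩, M * a + j, hk, ?_, ?_, ?_⟩
  · rw [div_le_one (by positivity)]
    linarith
  · rw [Nat.mul_add_mod, Nat.mod_eq_of_lt hj]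
  · field_simp
  · have h1 : (a : ℝ) / N ≤ ((M * a + j : ℕ) + 1 / 2) / (N * M) := by
      rw [div_le_div_iff₀ hN0 (by positivity)]
      push_cast
      have : (0 : ℝ) ≤ j := by positivity
      nlinarith
    have h2 : ((M * a + j : ℕ) + 1 / 2) / (N * M) ≤ ((a : ℝ) + 1) / N := by
      rw [div_le_div_iff₀ (by positivity) hN0]
      push_cast
      nlinarith
    have h3 : (a : ℝ) / N ≤ y := by rw [div_le_iff₀ hN0]; linarith
    have h4 : (y : ℝ) ≤ (a + 1) / N := by rw [le_div_iff₀ hN0]; linarith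
    rw [add_div (a : ℝ) 1] at h2 h4
    rw [abs_le]
    constructor <;> dsimp only <;> linarith

/-- The points of `[0,1]` in the `k`-th cell of length `1 / L`, away from its endpoints. -/
def openCell (L η : ℝ) (k : ℕ) : Set I01 := {x | (L * x : ℝ) ∈ Ioo (k + η) (k + 1 - η)}

/-- The closed version of `openCell`. -/
def closedCell (L η : ℝ) (k : ℕ) : Set I01 := {x | (L * x : ℝ) ∈ Icc (k + η) (k + 1 - η)}

theorem isOpen_openCell (L η : ℝ) (k : ℕ) : IsOpen (openCell L η k) :=
  isOpen_Ioo.preimage (by fun_prop : Continuous fun x : I01 => (L * x : ℝ))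

theorem isClosed_closedCell (L η : ℝ) (k : ℕ) : IsClosed (closedCell L η k) :=
  isClosed_Icc.preimage (by fun_prop : Continuous fun x : I01 => (L * x : ℝ))

theorem openCell_subset_closedCell (L η : ℝ) (k : ℕ) : openCell L η k ⊆ closedCell L η k :=
  preimage_mono Ioo_subset_Icc_self

theorem floor_eq_of_mem_closedCell {L η : ℝ} (hη : 0 < η) {k : ℕ} {x : I01}
    (hx : x ∈ closedCell L η k) : ⌊(L * x : ℝ)⌋₊ = k := by
  have h1 := hx.1
  have h2 := hx.2
  rw [Nat.floor_eq_iff (by linarith [Nat.cast_nonneg (α := ℝ) k])]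
  constructor <;> linarith

/-- The union of the open cells of colour `j`. -/
def colourSet (N M : ℕ) (η : ℝ) (j : ℕ) : Set I01 :=
  ⋃ k ∈ {k | k < N * M ∧ k % M = j}, openCell (N * M) η k

theorem isOpen_colourSet (N M : ℕ) (η : ℝ) (j : ℕ) : IsOpen (colourSet N M η j) :=
  isOpen_biUnion fun k _ => isOpen_openCell _ _ k

theorem closure_colourSet_subset (N M : ℕ) (η : ℝ) (j : ℕ) :
    closure (colourSet N M η j) ⊆
      ⋃ k ∈ {k | k < N * M ∧ k % M = j}, closedCell (N * M) η k := by
  refine closure_minimal (biUnion_mono subset_rfl fun k _ => openCell_subset_closedCell _ _ k) ?_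
  have hfin : {k | k < N * M ∧ k % M = j}.Finite :=
    (finite_lt_nat (N * M)).subset fun k hk => hk.1
  exact hfin.isClosed_biUnion fun k _ => isClosed_closedCell _ _ k

theorem volume_compl_colourSet_le {N M : ℕ} (hN : 0 < N) (hM : 0 < M) (j : ℕ) :
    volume (⋃ i ∈ {i | i < M ∧ i ≠ j}, colourSet N M (1 / (4 * M)) i)ᶜ
      ≤ ENNReal.ofReal (2 / M) := by
  have hN1 : (1 : ℝ) ≤ N := by exact_mod_cast hN
  have hM1 : (1 : ℝ) ≤ M := by exact_mod_cast hM
  have hL : (0 : ℝ) < N * M := by positivity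
  set η : ℝ := 1 / (4 * M) with hη
  have hη0 : 0 ≤ η := by positivity
  have hsub : ((↑) '' (⋃ i ∈ {i | i < M ∧ i ≠ j}, colourSet N M η i)ᶜ : Set ℝ) ⊆
      (⋃ k ∈ Finset.range (N * M + 1), Icc ((k - η) / (N * M)) ((k + η) / (N * M) : ℝ)) ∪
      ⋃ a ∈ Finset.range N, Icc ((a * M + j) / (N * M)) ((a * M + j + 1) / (N * M) : ℝ) := by
    rintro _ ⟨x, hx, rfl⟩
    by_contra hnot
    apply hx
    simp only [mem_union, mem_iUnion, not_or, not_exists, Finset.mem_range, mem_Icc,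
      div_le_iff₀ hL, le_div_iff₀ hL, not_and, not_le, exists_prop] at hnot
    obtain ⟨hball, hcell⟩ := hnot
    have hx0 : (0 : ℝ) ≤ N * M * x := mul_nonneg hL.le x.2.1
    have hx1 : (N * M * x : ℝ) ≤ N * M := mul_le_of_le_one_right hL.le x.2.2
    set k := ⌊(N * M * x : ℝ)⌋₊ with hk
    have hk0 : (k : ℝ) ≤ N * M * x := Nat.floor_le hx0
    have hk1 : (N * M * x : ℝ) < k + 1 := Nat.lt_floor_add_one _
    have hkL : k ≤ N * M := by
      have : (k : ℝ) ≤ (N * M : ℕ) := by push_cast; linarith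
      exact_mod_cast this
    have h1 := hball k (by omega) (by linarith)
    have hkL' : k < N * M := by
      refine lt_of_le_of_ne hkL fun h => ?_
      have : (k : ℝ) = N * M := by exact_mod_cast h
      linarith
    have h2 : (x * (N * M) : ℝ) < k + 1 - η := by
      by_contra! h
      have := hball (k + 1) (by omega) (by push_cast; linarith)
      push_cast at this
      linarith
    have h3 : k % M ≠ j := by
      intro h
      have hdm : k / M * M + j = k := by rw [← h]; exact Nat.div_add_mod' k M
      have hdm' : ((k / M : ℕ) : ℝ) * M + j = k := by exact_mod_cast hdm
      have := hcell (k / M) (Nat.div_lt_of_lt_mul (by rwa [mul_comm])) (by linarith)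
      linarith
    simp only [mem_iUnion]
    refine ⟨k % M, ⟨Nat.mod_lt _ hM, h3⟩, ?_⟩
    simp only [colourSet, mem_iUnion]
    exact ⟨k, ⟨hkL', rfl⟩, by linarith, by linarith⟩
  rw [← volume_image_subtype_coe measurableSet_Icc]
  refine (measure_mono hsub).trans ((measure_union_le _ _).trans ?_)
  refine (add_le_add (measure_biUnion_finset_le _ _) (measure_biUnion_finset_le _ _)).trans ?_
  have e1 : ∀ k : ℕ, ((k + η) / (N * M) - (k - η) / (N * M) : ℝ) = 2 * η / (N * M) :=
    fun k => by ring
  have e2 : ∀ a : ℕ, ((a * M + j + 1) / (N * M) - (a * M + j) / (N * M) : ℝ) = 1 / (N * M) :=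
    fun a => by ring
  simp only [Real.volume_Icc, e1, e2, Finset.sum_const, Finset.card_range, nsmul_eq_mul]
  rw [← ENNReal.ofReal_natCast, ← ENNReal.ofReal_natCast, ← ENNReal.ofReal_mul (by positivity),
    ← ENNReal.ofReal_mul (by positivity), ← ENNReal.ofReal_add (by positivity) (by positivity)]
  refine ENNReal.ofReal_le_ofReal ?_
  have h2 : (N * (1 / (N * M)) : ℝ) = 1 / M := by field_simp
  have h1 : ((N * M + 1 : ℕ) * (2 * η / (N * M)) : ℝ) ≤ 1 / M := by
    push_cast
    rw [← mul_div_assoc, div_le_div_iff₀ hL (by positivity)]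
    have : η * M = 1 / 4 := by rw [hη]; field_simp
    nlinarith [mul_le_mul hN1 hM1 zero_le_one (by positivity)]
  rw [h2]
  calc _ ≤ (1 / M + 1 / M : ℝ) := by linarith
    _ = 2 / M := by ring

theorem dense_trapSplit (m : ℕ) : Dense (trapSplit m) := by
  rw [Metric.dense_iff]
  intro f ε hε
  obtain ⟨δ, hδ, hfδ⟩ := Metric.uniformContinuous_iff.1
    (CompactSpace.uniformContinuous_of_continuous f.continuous) (ε / 4) (by positivity)
  obtain ⟨N, hN⟩ := exists_nat_one_div_lt (lt_min hδ (by positivity : 0 < ε / 4))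
  obtain ⟨hNδ, hNε⟩ := lt_min_iff.1 hN
  have hη : (0 : ℝ) < 1 / (4 * (m + 1 : ℕ)) := by positivity
  have hη' : (1 : ℝ) / (4 * (m + 1 : ℕ)) ≤ 1 / 4 := by
    gcongr
    push_cast
    linarith [Nat.cast_nonneg (α := ℝ) m]
  set η : ℝ := 1 / (4 * (m + 1 : ℕ)) with hηdef
  set L : ℝ := (N + 1 : ℕ) * (m + 1 : ℕ) with hLdef
  have hL : (0 : ℝ) < L := by positivity
  have hLN : 1 / L ≤ 1 / (N + 1 : ℝ) := by
    rw [hLdef]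
    push_cast
    gcongr
    nlinarith [Nat.cast_nonneg (α := ℝ) m, Nat.cast_nonneg (α := ℝ) N]
  let mid : ℕ → I01 := fun k => projIcc 0 1 zero_le_one ((k + 1 / 2) / L)
  choose c k hkL hkm hck hcf using fun i : ℕ =>
    exists_midpoint_near N.succ_pos (Nat.mod_lt i m.succ_pos) (f (mid i))
  set K : Set I01 := ⋃ i ∈ {i | i < (N + 1) * (m + 1)}, closedCell L η i with hK
  have hKc : IsClosed K :=
    (finite_lt_nat _).isClosed_biUnion fun i _ => isClosed_closedCell _ _ i
  have hcont : ContinuousOn (fun x : I01 => c ⌊(L * x : ℝ)⌋₊) K := by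
    intro x hx
    simp only [hK, mem_iUnion] at hx
    obtain ⟨i, -, hxi⟩ := hx
    have hmem : openCell L 0 i ∈ 𝓝 x := (isOpen_openCell L 0 i).mem_nhds
      ⟨by linarith [hxi.1], by linarith [hxi.2]⟩
    have heq : (fun x : I01 => c ⌊(L * x : ℝ)⌋₊) =ᶠ[𝓝 x] fun _ => c i := by
      filter_upwards [hmem] with z hz
      have h1 := hz.1
      have h2 := hz.2
      congr 1
      rw [Nat.floor_eq_iff (by linarith [Nat.cast_nonneg (α := ℝ) i])]
      constructor <;> linarith
    exact (continuousAt_const.congr heq.symm).continuousWithinAt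
  have hclose : ∀ x ∈ K, |(c ⌊(L * x : ℝ)⌋₊ : ℝ) - f x| ≤ ε / 2 := by
    intro x hx
    simp only [hK, mem_iUnion] at hx
    obtain ⟨i, -, hxi⟩ := hx
    rw [floor_eq_of_mem_closedCell hη hxi]
    have hdist : dist (mid i) x < δ := by
      have h := (LipschitzWith.projIcc (zero_le_one (α := ℝ))).dist_le_mul ((i + 1 / 2) / L) x
      rw [projIcc_val] at h
      refine lt_of_le_of_lt h (lt_of_le_of_lt ?_ (hLN.trans_lt hNδ))
      have h1 := hxi.1
      have h2 := hxi.2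
      have h3 : (i + 1 / 2) / L - x = (i + 1 / 2 - L * x) / L := by field_simp
      rw [NNReal.coe_one, one_mul, Real.dist_eq, h3, abs_div, abs_of_pos hL]
      gcongr
      rw [abs_le]
      constructor <;> linarith
    have h1 := hfδ hdist
    rw [Subtype.dist_eq, Real.dist_eq] at h1
    have h2 := hcf i
    push_cast at h2
    calc |(c i : ℝ) - f x| ≤ |(c i : ℝ) - f (mid i)| + |(f (mid i) : ℝ) - f x| := abs_sub_le _ _ _
      _ ≤ ε / 2 := by linarith
  obtain ⟨g, hgf, hgc⟩ := exists_dist_le_eqOn f hKc hcont (by positivity) hclose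
  refine ⟨g, by rw [Metric.mem_ball]; linarith,
    fun j => colourSet (N + 1) (m + 1) η j, fun j => isOpen_colourSet _ _ _ _, ?_, ?_, ?_⟩
  · rintro i j ⟨x, hxi, hxj⟩
    simp only [colourSet, mem_iUnion] at hxi hxj
    obtain ⟨a, ha, hxa⟩ := hxi
    obtain ⟨b, hb, hxb⟩ := hxj
    have hab : a = b :=
      (floor_eq_of_mem_closedCell hη (openCell_subset_closedCell _ _ _ hxa)).symm.trans
        (floor_eq_of_mem_closedCell hη (openCell_subset_closedCell _ _ _ hxb))
    exact Fin.ext (ha.2.symm.trans ((congrArg (· % (m + 1)) hab).trans hb.2))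
  · intro j x hx
    have hx' := closure_colourSet_subset _ _ _ _ hx
    simp only [mem_iUnion] at hx'
    obtain ⟨i, hi, hxi⟩ := hx'
    have hxK : x ∈ K := mem_biUnion (x := i) hi.1 hxi
    rw [hgc hxK]
    simp only [colourSet, mem_iUnion]
    refine ⟨k i, ⟨hkL i, (hkm i).trans hi.2⟩, ?_⟩
    have hfl : ⌊(L * x : ℝ)⌋₊ = i := floor_eq_of_mem_closedCell hη hxi
    have := hck i
    simp only [hfl, openCell, mem_ofPred_eq]
    constructor <;> linarith
  · intro j
    have hunion : (⋃ i ∈ {i | i < m + 1 ∧ i ≠ (j : ℕ)}, colourSet (N + 1) (m + 1) η i) ⊆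
        ⋃ i ∈ {i : Fin (m + 1) | i ≠ j}, colourSet (N + 1) (m + 1) η i := by
      refine iUnion₂_subset fun i hi => ?_
      exact subset_biUnion_of_mem (u := fun i : Fin (m + 1) => colourSet (N + 1) (m + 1) η i)
        (show (⟨i, hi.1⟩ : Fin (m + 1)) ∈ {i : Fin (m + 1) | i ≠ j} from
          fun h => hi.2 (congrArg Fin.val h))
    refine (measure_mono (compl_subset_compl.2 hunion)).trans ?_
    exact (volume_compl_colourSet_le N.succ_pos m.succ_pos j).trans_eq (by rw [Nat.cast_succ])

theorem omegaLim_inter_trap_unique {X ι : Type*} [TopologicalSpace X] [CompactSpace X] [T2Space X]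
    {f : X → X} (hf : Continuous f) {U : ι → Set X} (hU : ∀ j, IsOpen (U j))
    (hd : ∀ i j, (U i ∩ U j).Nonempty → i = j) (hg : ∀ j, MapsTo f (closure (U j)) (U j)) (x : X)
    (i j : ι) (hi : (omegaLim f x ∩ U i).Nonempty) (hj : (omegaLim f x ∩ U j).Nonempty) :
    i = j := by
  obtain ⟨y, hy, hyi⟩ := hi
  obtain ⟨z, hz, hzj⟩ := hj
  obtain ⟨n, hn⟩ := exists_iterate_mem_of_mem_omegaLim (hU i) hy hyi
  exact hd i j ⟨z, omegaLim_subset_of_iterate_mem hf (hg i) hn hz, hzj⟩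

theorem measSupport_inter_trap_unique {X ι : Type*} [TopologicalSpace X] [MeasurableSpace X]
    [BorelSpace X] {f : X → X} {U : ι → Set X} (hU : ∀ j, IsOpen (U j))
    (hd : ∀ i j, (U i ∩ U j).Nonempty → i = j) (hg : ∀ j, MapsTo f (closure (U j)) (U j))
    {μ : Measure X} [IsProbabilityMeasure μ] (hμ : Ergodic f μ)
    (i j : ι) (hi : (measSupport μ ∩ U i).Nonempty) (hj : (measSupport μ ∩ U j).Nonempty) :
    i = j := by
  have key : ∀ i, (measSupport μ ∩ U i).Nonempty → U i =ᵐ[μ] univ := by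
    rintro i ⟨y, hy, hyi⟩
    refine (hμ.ae_empty_or_univ_of_ae_le_preimage (hU i).measurableSet.nullMeasurableSet
      ((hg i).mono_left subset_closure).subset_preimage.eventuallyLE).resolve_left fun h => ?_
    exact (hy (U i) (hU i) hyi).ne' (by rw [measure_congr h, measure_empty])
  refine hd i j (nonempty_of_measure_ne_zero (μ := μ) ?_)
  rw [measure_congr ((key i hi).inter (key j hj)), univ_inter, measure_univ]
  exact one_ne_zero

/-- for a residual set of maps `g`, the basin of the ω-limit set of every
point has Lebesgue measure zero; in particular the basin of the support of every ergodic
invariant probability measure is Lebesgue-null. -/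
theorem stmt16 :
    ∃ G ∈ residual C(I01, I01), ∀ g ∈ G,
      (∀ x : I01, (volume : Measure I01) (basin ⇑g (omegaLim ⇑g x)) = 0) ∧
      (∀ μ : Measure I01, IsProbabilityMeasure μ → Ergodic ⇑g μ →
        (volume : Measure I01) (basin ⇑g (measSupport μ)) = 0) := by
  refine ⟨⋂ m, trapSplit m, countable_iInter_mem.2 fun m =>
    residual_of_dense_open (isOpen_trapSplit m) (dense_trapSplit m), fun g hg => ?_⟩
  rw [mem_iInter] at hg
  have hlim : Tendsto (fun m : ℕ => ENNReal.ofReal (2 / (m + 1))) atTop (𝓝 0) := by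
    have h := ENNReal.tendsto_ofReal
      ((tendsto_one_div_add_atTop_nhds_zero_nat (𝕜 := ℝ)).const_mul 2)
    simpa only [mul_one_div, mul_zero, ENNReal.ofReal_zero] using h
  refine ⟨fun x => ?_, fun μ _ hμ => ?_⟩
  · refine le_antisymm (ge_of_tendsto' hlim fun m => ?_) zero_le
    obtain ⟨U, hU, hd, hm, hv⟩ := hg m
    exact volume_basin_le hm hv (omegaLim_inter_trap_unique g.continuous hU hd hm x)
  · refine le_antisymm (ge_of_tendsto' hlim fun m => ?_) zero_le
    obtain ⟨U, hU, hd, hm, hv⟩ := hg m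
    exact volume_basin_le hm hv (measSupport_inter_trap_unique hU hd hm hμ)
end
end

section
/- There exists a residual set G ⊆ C([0,1]) such that no g ∈ G admits a physical (SRB) measure: for every g ∈ G there is no g-invariant Borel probability measure μ on [0,1] for which the set {x ∈ [0,1] : (1/n) Σ_{i=0}^{n−1} δ_{g^i(x)} converges weakly to μ} has positive Lebesgue measure. -/
open MeasureTheory Set Filter Topology

noncomputable section

/-- Weak convergence of the empirical measures `(1/n) ∑_{i<n} δ_{f^i x}` to `μ`:
the averages of every continuous function along the orbit converge to its integral. -/
def empiricalConv {X : Type*} [TopologicalSpace X] [MeasurableSpace X]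
    (f : X → X) (μ : Measure X) (x : X) : Prop :=
  ∀ φ : C(X, ℝ), Tendsto (fun n => (∑ i ∈ Finset.range n, φ (f^[i] x)) / n)
    atTop (nhds (∫ y, φ y ∂μ))

/-- `g` traps all but `ε` of the volume in finitely many disjoint closed sets,
each of volume at most `ε`. -/
def HasTrappingFamily (ε : ℝ) (g : C(I01, I01)) : Prop :=
  ∃ (M : ℕ) (K : Fin M → Set I01),
    (∀ j, IsClosed (K j)) ∧ (∀ i j, i ≠ j → Disjoint (K i) (K j)) ∧
    (∀ j, volume (K j) ≤ ENNReal.ofReal ε) ∧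
    volume (⋃ j, K j)ᶜ ≤ ENNReal.ofReal ε ∧
    ∀ j, MapsTo g (K j) (interior (K j))

theorem isOpen_hasTrappingFamily (ε : ℝ) : IsOpen {g | HasTrappingFamily ε g} := by
  rw [isOpen_iff_mem_nhds]
  rintro g ⟨M, K, hcl, hdis, hvol, hcompl, hmaps⟩
  have h : ∀ᶠ g' : C(I01, I01) in 𝓝 g, ∀ j, MapsTo g' (K j) (interior (K j)) :=
    eventually_all.2 fun j =>
      (ContinuousMap.isOpen_setOfPred_mapsTo (hcl j).isCompact isOpen_interior).mem_nhds (hmaps j)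
  exact h.mono fun g' hg' => ⟨M, K, hcl, hdis, hvol, hcompl, hg'⟩

/-- A measure whose basin meets a closed forward-invariant set is carried by that set. -/
theorem measure_compl_eq_zero_of_empiricalConv {X : Type*} [MetricSpace X] [CompactSpace X]
    [MeasurableSpace X] [BorelSpace X] {g : X → X} {μ : Measure X} [IsFiniteMeasure μ]
    {K : Set X} (hK : IsClosed K) (hmaps : MapsTo g K K) {x : X} (hx : x ∈ K)
    (hconv : empiricalConv g μ x) : μ Kᶜ = 0 := by
  let φ : C(X, ℝ) := ⟨fun y => Metric.infDist y K, Metric.continuous_infDist_pt K⟩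
  have horbit : ∀ i, φ (g^[i] x) = 0 := fun i =>
    Metric.infDist_zero_of_mem (hmaps.iterate i hx)
  have hlim := hconv φ
  simp only [horbit, Finset.sum_const_zero, zero_div] at hlim
  have hint : ∫ y, φ y ∂μ = 0 := tendsto_nhds_unique hlim tendsto_const_nhds
  have hnonneg : 0 ≤ (φ : X → ℝ) := fun y => Metric.infDist_nonneg
  have hae := (integral_eq_zero_iff_of_nonneg hnonneg
    (φ.continuous.integrable_of_hasCompactSupport (HasCompactSupport.of_compactSpace _))).1 hint
  have : ∀ᵐ y ∂μ, y ∈ K := by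
    filter_upwards [hae] with y hy
    exact (hK.mem_iff_infDist_zero ⟨x, hx⟩).2 hy
  exact this

theorem HasTrappingFamily.volume_basin_le {ε : ℝ} {g : C(I01, I01)} (h : HasTrappingFamily ε g)
    (μ : Measure I01) [IsProbabilityMeasure μ] :
    volume {x | empiricalConv g μ x} ≤ 2 * ENNReal.ofReal ε := by
  obtain ⟨M, K, hcl, hdis, hvol, hcompl, hmaps⟩ := h
  have hnull : ∀ j, ∀ x ∈ K j, empiricalConv g μ x → μ (K j)ᶜ = 0 := fun j x hx hconv =>
    measure_compl_eq_zero_of_empiricalConv (hcl j)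
      ((hmaps j).mono_right interior_subset) hx hconv
  rw [two_mul]
  by_cases hj : ∃ j, ∃ x ∈ K j, empiricalConv g μ x
  · obtain ⟨j, x, hx, hconv⟩ := hj
    have hsub : {x | empiricalConv g μ x} ⊆ K j ∪ (⋃ j, K j)ᶜ := by
      intro y hy
      by_contra hcon
      simp only [mem_union, mem_compl_iff, not_or, not_not, mem_iUnion] at hcon
      obtain ⟨hyj, i, hyi⟩ := hcon
      have hij : i ≠ j := by rintro rfl; exact hyj hyi
      have huniv : (univ : Set I01) ⊆ (K i)ᶜ ∪ (K j)ᶜ := by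
        rw [← compl_inter, (hdis i j hij).inter_eq, compl_empty]
      have := measure_mono_null huniv
        (measure_union_null (hnull i y hyi hy) (hnull j x hx hconv))
      simp at this
    exact (measure_mono hsub).trans ((measure_union_le _ _).trans (add_le_add (hvol j) hcompl))
  · refine (measure_mono ?_).trans (hcompl.trans le_self_add)
    intro y hy hcon
    obtain ⟨i, hi⟩ := mem_iUnion.1 hcon
    exact hj ⟨i, y, hi, hy⟩

theorem volume_preimage_mul_Icc_le {n a b : ℝ} (hn : 0 < n) :
    volume ((fun x : I01 => n * (x : ℝ)) ⁻¹' Icc a b) ≤ ENNReal.ofReal ((b - a) / n) := by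
  rw [← volume_image_subtype_coe measurableSet_Icc]
  have hsub : Subtype.val '' ((fun x : I01 => n * (x : ℝ)) ⁻¹' Icc a b) ⊆ Icc (a / n) (b / n) := by
    rintro _ ⟨x, ⟨h1, h2⟩, rfl⟩
    exact ⟨(div_le_iff₀' hn).2 h1, (le_div_iff₀' hn).2 h2⟩
  refine (measure_mono hsub).trans_eq ?_
  rw [Real.volume_Icc, sub_div]

/-- The part of the `c`-th of `n` equal subintervals at relative distance at least `η`
from its endpoints. -/
def cellCore (n : ℕ) (η : ℝ) (c : ℕ) : Set I01 :=
  (fun x : I01 => n * (x : ℝ)) ⁻¹' Icc (c + η) (c + 1 - η)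

theorem isClosed_cellCore (n : ℕ) (η : ℝ) (c : ℕ) : IsClosed (cellCore n η c) :=
  isClosed_Icc.preimage (by fun_prop)

theorem floor_eq_of_mem_cellCore {n c : ℕ} {η : ℝ} (hη : 0 < η) {x : I01}
    (hx : x ∈ cellCore n η c) : ⌊n * (x : ℝ)⌋₊ = c := by
  obtain ⟨h1, h2⟩ := hx
  rw [Nat.floor_eq_iff (by have := x.2.1; positivity)]
  constructor <;> linarith

/-- The union of the cores of the cells whose index is congruent to `j` modulo `M`. -/
def residueCores (n M : ℕ) (η : ℝ) (j : ℕ) : Set I01 :=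
  ⋃ c ∈ (Finset.range n).filter (fun c => c % M = j), cellCore n η c

theorem mem_residueCores {n M : ℕ} {η : ℝ} {j : ℕ} {x : I01} :
    x ∈ residueCores n M η j ↔ ∃ c < n, c % M = j ∧ x ∈ cellCore n η c := by
  simp [residueCores, and_assoc]

theorem isClosed_residueCores (n M : ℕ) (η : ℝ) (j : ℕ) : IsClosed (residueCores n M η j) :=
  isClosed_biUnion_finset fun c _ => isClosed_cellCore n η c

theorem disjoint_residueCores {n M : ℕ} {η : ℝ} (hη : 0 < η) {i j : ℕ} (hij : i ≠ j) :
    Disjoint (residueCores n M η i) (residueCores n M η j) := by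
  rw [Set.disjoint_left]
  intro x hi hj
  obtain ⟨c, -, hci, hxc⟩ := mem_residueCores.1 hi
  obtain ⟨d, -, hdj, hxd⟩ := mem_residueCores.1 hj
  rw [← floor_eq_of_mem_cellCore hη hxc] at hci
  rw [← floor_eq_of_mem_cellCore hη hxd] at hdj
  exact hij (hci.symm.trans hdj)

theorem volume_residueCores_le {N M : ℕ} (hN : 0 < N) (hM : 0 < M) {η : ℝ} (hη : 0 < η) (j : ℕ) :
    volume (residueCores (N * M) M η j) ≤ ENNReal.ofReal (1 / M) := by
  have hn : (0 : ℝ) < (N * M : ℕ) := by positivity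
  have hcard : ((Finset.range (N * M)).filter (fun c => c % M = j)).card ≤ N := by
    refine (Finset.card_le_card_of_injOn (t := Finset.range N) (fun c => c / M) ?_ ?_).trans_eq
      (Finset.card_range N)
    · intro c hc
      simp only [Finset.coe_filter, Finset.mem_range, mem_ofPred_eq] at hc
      simpa using Nat.div_lt_of_lt_mul (by rw [mul_comm]; exact hc.1)
    · intro c hc d hd hcd
      simp only [Finset.coe_filter, Finset.mem_range, mem_ofPred_eq] at hc hd hcd
      rw [← Nat.div_add_mod c M, ← Nat.div_add_mod d M, hc.2, hd.2, hcd]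
  calc volume (residueCores (N * M) M η j)
      ≤ ∑ c ∈ (Finset.range (N * M)).filter (fun c => c % M = j),
          volume (cellCore (N * M) η c) := measure_biUnion_finset_le _ _
    _ ≤ ∑ c ∈ (Finset.range (N * M)).filter (fun c => c % M = j),
          ENNReal.ofReal (1 / (N * M : ℕ)) := by
        refine Finset.sum_le_sum fun c _ => (volume_preimage_mul_Icc_le hn).trans ?_
        refine ENNReal.ofReal_le_ofReal ?_
        gcongr
        linarith
    _ ≤ N * ENNReal.ofReal (1 / (N * M : ℕ)) := by
        rw [Finset.sum_const, nsmul_eq_mul]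
        gcongr
    _ = ENNReal.ofReal (1 / M) := by
        rw [← ENNReal.ofReal_natCast, ← ENNReal.ofReal_mul (by positivity)]
        congr 1
        push_cast
        field_simp

theorem volume_compl_iUnion_residueCores_le {n M : ℕ} (hn : 0 < n) (hM : 0 < M) {η : ℝ}
    (hη : 0 < η) :
    volume (⋃ j : Fin M, residueCores n M η j)ᶜ ≤ ENNReal.ofReal (2 * η) := by
  have hn' : (0 : ℝ) < n := by positivity
  have hsub : (⋃ j : Fin M, residueCores n M η j)ᶜ ⊆
      ⋃ c ∈ Finset.range n, ((fun x : I01 => n * (x : ℝ)) ⁻¹' Icc c (c + η) ∪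
        (fun x : I01 => n * (x : ℝ)) ⁻¹' Icc (c + 1 - η) (c + 1)) := by
    intro x hx
    obtain ⟨c, hc, h1, h2⟩ : ∃ c < n, (c : ℝ) ≤ n * (x : ℝ) ∧ n * (x : ℝ) ≤ c + 1 := by
      rcases lt_or_ge (n * (x : ℝ)) n with h | h
      · have h0 : 0 ≤ n * (x : ℝ) := by have := x.2.1; positivity
        exact ⟨⌊n * (x : ℝ)⌋₊, (Nat.floor_lt h0).2 h, Nat.floor_le h0, (Nat.lt_floor_add_one _).le⟩
      · have hx1 : n * (x : ℝ) ≤ n := mul_le_of_le_one_right hn'.le x.2.2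
        refine ⟨n - 1, by omega, ?_, ?_⟩ <;>
        · rw [Nat.cast_pred hn]
          linarith
    simp only [mem_iUnion, Finset.mem_range, mem_union, mem_preimage, mem_Icc, exists_prop]
    refine ⟨c, hc, ?_⟩
    by_contra hcon
    rw [not_or, not_and, not_and'] at hcon
    refine hx (mem_iUnion.2 ⟨⟨c % M, Nat.mod_lt _ hM⟩, mem_residueCores.2 ⟨c, hc, rfl, ?_, ?_⟩⟩)
    · exact (not_le.1 (hcon.1 h1)).le
    · exact (not_le.1 (hcon.2 h2)).le
  calc _ ≤ _ := measure_mono hsub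
    _ ≤ ∑ c ∈ Finset.range n, _ := measure_biUnion_finset_le _ _
    _ ≤ ∑ c ∈ Finset.range n, ENNReal.ofReal (2 * η / n) := by
        refine Finset.sum_le_sum fun c _ => (measure_union_le _ _).trans ?_
        refine (add_le_add (volume_preimage_mul_Icc_le hn')
          (volume_preimage_mul_Icc_le hn')).trans ?_
        rw [← ENNReal.ofReal_add (by ring_nf; positivity) (by ring_nf; positivity)]
        refine ENNReal.ofReal_le_ofReal (le_of_eq ?_)
        ring
    _ = ENNReal.ofReal (2 * η) := by
        rw [Finset.sum_const, nsmul_eq_mul, Finset.card_range, ← ENNReal.ofReal_natCast,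
          ← ENNReal.ofReal_mul (by positivity)]
        congr 1
        field_simp

theorem mem_interior_residueCores {n M d : ℕ} (hd : d < n) {η : ℝ} (hη : η < 1 / 2) {y : I01}
    (hy : n * (y : ℝ) = d + 1 / 2) : y ∈ interior (residueCores n M η (d % M)) := by
  refine mem_interior.2 ⟨(fun x : I01 => n * (x : ℝ)) ⁻¹' Ioo (d + η) (d + 1 - η), ?_, ?_, ?_⟩
  · exact fun x hx => mem_residueCores.2 ⟨d, hd, rfl, hx.1.le, hx.2.le⟩
  · exact isOpen_Ioo.preimage (by fun_prop)
  · constructor <;> linarith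

/-- Every `y` is within `1 / N` of the centre of one of `N * M` equal cells with prescribed
residue `j` modulo `M`. -/
theorem exists_cell_center_near {N M : ℕ} (hN : 0 < N) (y : I01) {j : ℕ} (hj : j < M) :
    ∃ d < N * M, d % M = j ∧ ∃ v : I01, (N * M : ℕ) * (v : ℝ) = d + 1 / 2 ∧
      |(v : ℝ) - y| ≤ 1 / N := by
  have hN' : (0 : ℝ) < N := by positivity
  have hM : 0 < M := by omega
  have hM' : (0 : ℝ) < M := by positivity
  obtain ⟨e, he, h1, h2⟩ : ∃ e < N, (e : ℝ) ≤ N * (y : ℝ) ∧ N * (y : ℝ) ≤ e + 1 := by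
    rcases lt_or_ge (N * (y : ℝ)) N with h | h
    · have h0 : 0 ≤ N * (y : ℝ) := by have := y.2.1; positivity
      exact ⟨⌊N * (y : ℝ)⌋₊, (Nat.floor_lt h0).2 h, Nat.floor_le h0, (Nat.lt_floor_add_one _).le⟩
    · have hx1 : N * (y : ℝ) ≤ N := mul_le_of_le_one_right hN'.le y.2.2
      refine ⟨N - 1, by omega, ?_, ?_⟩ <;>
      · rw [Nat.cast_pred hN]
        linarith
  have hj' : (j : ℝ) + 1 ≤ M := by exact_mod_cast hj
  have he' : (e : ℝ) + 1 ≤ N := by exact_mod_cast he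
  set w : ℝ := ((e * M + j : ℕ) + 1 / 2) / (N * M : ℕ) with hw
  have hw1 : (e : ℝ) / N ≤ w := by
    rw [hw, div_le_div_iff₀ hN' (by positivity)]
    push_cast
    nlinarith [mul_nonneg hN'.le (Nat.cast_nonneg (α := ℝ) j)]
  have hw2 : w ≤ (e + 1) / N := by
    rw [hw, div_le_div_iff₀ (by positivity) hN']
    push_cast
    nlinarith [mul_le_mul_of_nonneg_left hj' hN'.le]
  have hw01 : w ∈ Icc (0 : ℝ) 1 :=
    ⟨by positivity, hw2.trans ((div_le_one hN').2 he')⟩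
  refine ⟨e * M + j, ?_, ?_, ⟨w, hw01⟩, ?_, ?_⟩
  · calc e * M + j < (e + 1) * M := by rw [add_mul, one_mul]; omega
      _ ≤ N * M := Nat.mul_le_mul_right _ he
  · rw [Nat.mul_add_mod_self_right, Nat.mod_eq_of_lt hj]
  · simp only [hw]
    field_simp
  · have hy1 : (e : ℝ) / N ≤ y := (div_le_iff₀' hN').2 h1
    have hy2 : (y : ℝ) ≤ (e + 1) / N := (le_div_iff₀' hN').2 h2
    rw [add_div] at hw2 hy2
    rw [abs_le]
    constructor <;> simp only <;> linarith

/-- Prescribing nearby constant values on the cell cores is realised by a uniformly close map. -/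
theorem exists_eq_on_cellCore_dist_le (f : C(I01, I01)) {n : ℕ} {η s : ℝ} (hη : 0 < η)
    (hs : 0 ≤ s) (v : ℕ → I01)
    (hv : ∀ c < n, ∀ x ∈ cellCore n η c, |(v c : ℝ) - f x| ≤ s) :
    ∃ g : C(I01, I01), (∀ c < n, ∀ x ∈ cellCore n η c, g x = v c) ∧ dist g f ≤ s := by
  let K : Set I01 := ⋃ c : Fin n, cellCore n η c
  let h : I01 → ℝ := fun x => v ⌊n * (x : ℝ)⌋₊ - f x
  have hcore : ∀ c, ∀ x ∈ cellCore n η c, h x = v c - f x := fun c x hx => by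
    simp only [h, floor_eq_of_mem_cellCore hη hx]
  have hcont : ContinuousOn h K := by
    refine (locallyFinite_of_finite _).continuousOn_iUnion
      (fun c => isClosed_cellCore n η c) fun c => ?_
    refine ContinuousOn.congr (f := fun x => (v c : ℝ) - f x) ?_ (hcore c)
    exact Continuous.continuousOn (by fun_prop)
  obtain ⟨H, hH, hHK⟩ := ContinuousMap.exists_restrict_eq_forall_mem_of_closed
    (⟨K.domRestrict h, hcont.domRestrict⟩ : C(K, ℝ)) (t := Icc (-s) s)
    (by
      rintro ⟨x, hx⟩
      obtain ⟨c, hc⟩ := mem_iUnion.1 hx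
      change h x ∈ Icc (-s) s
      rw [hcore c x hc]
      exact abs_le.1 (hv c c.2 x hc))
    ⟨0, by simpa using hs⟩ (isClosed_iUnion_of_finite fun c : Fin n => isClosed_cellCore n η c)
  let g : C(I01, I01) := ⟨fun x => projIcc 0 1 zero_le_one (f x + H x),
    continuous_projIcc.comp (by fun_prop)⟩
  refine ⟨g, fun c hc x hx => ?_, ?_⟩
  · have hHx : H x = h x := DFunLike.congr_fun hHK ⟨x, mem_iUnion.2 ⟨⟨c, hc⟩, hx⟩⟩
    change projIcc 0 1 zero_le_one (f x + H x) = v c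
    rw [hHx, hcore c x hx, add_sub_cancel, projIcc_val]
  · refine (ContinuousMap.dist_le hs).2 fun x => ?_
    have hproj := abs_projIcc_sub_projIcc (zero_le_one (α := ℝ)) (c := f x + H x) (d := f x)
    rw [projIcc_val, add_sub_cancel_left] at hproj
    exact hproj.trans (abs_le.2 (hH x))

theorem dense_hasTrappingFamily {ε : ℝ} (hε : 0 < ε) : Dense {g | HasTrappingFamily ε g} := by
  rw [Metric.dense_iff]
  intro f r hr
  obtain ⟨δ, hδ, hf⟩ := Metric.uniformContinuous_iff.1
    (CompactSpace.uniformContinuous_of_continuous f.continuous) (r / 4) (by positivity)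
  obtain ⟨M, hM, hMε⟩ : ∃ M : ℕ, 0 < M ∧ 1 / (M : ℝ) ≤ ε := by
    obtain ⟨m, hm⟩ := exists_nat_one_div_lt hε
    exact ⟨m + 1, m.succ_pos, by exact_mod_cast hm.le⟩
  obtain ⟨N, hN, hNδ⟩ : ∃ N : ℕ, 0 < N ∧ 1 / (N : ℝ) < min δ (r / 4) := by
    obtain ⟨m, hm⟩ := exists_nat_one_div_lt (lt_min hδ (by positivity : 0 < r / 4))
    exact ⟨m + 1, m.succ_pos, by exact_mod_cast hm⟩
  obtain ⟨hNδ, hNr⟩ := lt_min_iff.1 hNδ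
  obtain ⟨η, hη, hηε, hη2⟩ : ∃ η : ℝ, 0 < η ∧ 2 * η ≤ ε ∧ η < 1 / 2 :=
    ⟨min (ε / 2) (1 / 4), by positivity, by linarith [min_le_left (ε / 2) (1 / 4)],
      by linarith [min_le_right (ε / 2) (1 / 4)]⟩
  have hn : (0 : ℝ) < (N * M : ℕ) := by positivity
  have hnδ : 1 / ((N * M : ℕ) : ℝ) < δ := by
    refine lt_of_le_of_lt (one_div_le_one_div_of_le (by positivity) ?_) hNδ
    exact_mod_cast Nat.le_mul_of_pos_right N hM
  choose d hd hdmod v hv hvnear using fun c : ℕ =>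
    exists_cell_center_near hN (f (projIcc 0 1 zero_le_one (c / (N * M : ℕ)))) (Nat.mod_lt c hM)
  obtain ⟨g, hg, hgf⟩ := exists_eq_on_cellCore_dist_le f hη (by positivity : 0 ≤ r / 2) v
    (n := N * M) (by
      intro c hc x hx
      have hdist : dist (projIcc 0 1 zero_le_one (c / (N * M : ℕ) : ℝ)) x < δ := by
        have hproj := abs_projIcc_sub_projIcc (zero_le_one (α := ℝ))
          (c := (c / (N * M : ℕ) : ℝ)) (d := x)
        rw [projIcc_val] at hproj
        refine lt_of_le_of_lt (hproj.trans ?_) hnδ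
        have h1 : (c : ℝ) / (N * M : ℕ) ≤ x := (div_le_iff₀' hn).2 (by linarith [hx.1])
        have h2 : (x : ℝ) ≤ (c + 1) / (N * M : ℕ) := (le_div_iff₀' hn).2 (by linarith [hx.2])
        rw [add_div] at h2
        rw [abs_le]
        constructor
        · linarith
        · linarith [one_div_pos.2 hn]
      have h1 := hf hdist
      rw [Subtype.dist_eq, Real.dist_eq] at h1
      have h2 := abs_sub_le (v c : ℝ) (f (projIcc 0 1 zero_le_one (c / (N * M : ℕ) : ℝ))) (f x)
      linarith [hvnear c])
  refine ⟨g, Metric.mem_ball.2 (by linarith), M, fun j => residueCores (N * M) M η j,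
    fun j => isClosed_residueCores _ _ _ _,
    fun i j hij => disjoint_residueCores hη (Fin.val_injective.ne hij),
    fun j => (volume_residueCores_le hN hM hη j).trans (ENNReal.ofReal_le_ofReal hMε),
    (volume_compl_iUnion_residueCores_le (Nat.mul_pos hN hM) hM hη).trans
      (ENNReal.ofReal_le_ofReal hηε), fun j x hx => ?_⟩
  obtain ⟨c, hc, hcj, hxc⟩ := mem_residueCores.1 hx
  change g x ∈ interior (residueCores (N * M) M η j)
  rw [hg c hc x hxc, ← hcj, ← hdmod c]
  exact mem_interior_residueCores (hd c) hη2 (hv c)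

/-- for a residual set of maps `g`, there is no physical (SRB) measure:
no `g`-invariant Borel probability measure whose weak basin has positive Lebesgue
measure. -/
theorem stmt17 :
    ∃ G ∈ residual C(I01, I01), ∀ g ∈ G,
      ¬ ∃ μ : Measure I01, IsProbabilityMeasure μ ∧
        Measure.map ⇑g μ = μ ∧
        0 < (volume : Measure I01) {x | empiricalConv ⇑g μ x} := by
  refine ⟨⋂ k : ℕ, {g | HasTrappingFamily (1 / ((k : ℝ) + 1)) g},
    countable_iInter_mem.2 fun k => residual_of_dense_open (isOpen_hasTrappingFamily _)
      (dense_hasTrappingFamily (by positivity)), ?_⟩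
  rintro g hg ⟨μ, hμ, -, hpos⟩
  have hle : ∀ k : ℕ, volume {x | empiricalConv g μ x} ≤
      2 * ENNReal.ofReal (1 / ((k : ℝ) + 1)) := fun k =>
    (mem_iInter.1 hg k).volume_basin_le μ
  have hlim : Tendsto (fun k : ℕ => 2 * ENNReal.ofReal (1 / ((k : ℝ) + 1))) atTop (𝓝 0) := by
    have h := ENNReal.Tendsto.const_mul (a := 2)
      (ENNReal.tendsto_ofReal (tendsto_one_div_add_atTop_nhds_zero_nat (𝕜 := ℝ)))
      (Or.inr ENNReal.ofNat_ne_top)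
    simpa using h
  exact hpos.not_ge (ge_of_tendsto' hlim hle)
end
end
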